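/- (Necessity of NIAC.) Let X, Y, A be finite nonempty sets, μ a prior on X, K ≥ 1, and C a real-valued function on the set of stochastic kernels from X to Y. Suppose for each k ∈ {1,…,K}: u_k : X × A → ℝ is a utility, α_k is a stochastic kernel from X to Y satisfying J(μ, α_k, u_k) − C(α_k) ≥ J(μ, α, u_k) − C(α) for every stochastic kernel α from X to Y, and β_k is an optimal decision rule for (μ, α_k, u_k). Let q_k be the revealed joint distribution of (μ, α_k, β_k) and c_k = C(α_k). Then q_1,…,q_K, u_1,…,u_K and c_1,…,c_K satisfy NIAC. -/

import Mathlib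

open Finset

/-- A stochastic kernel from `S` to `T`: `κ s t` is the probability of `t` given `s`. -/
def IsKernel {S T : Type*} [Fintype T] (κ : S → T → ℝ) : Prop :=
  (∀ s t, 0 ≤ κ s t) ∧ ∀ s, ∑ t, κ s t = 1

/-- A prior on a finite set `X`. -/
def IsPrior {X : Type*} [Fintype X] (μ : X → ℝ) : Prop :=
  (∀ x, 0 ≤ μ x) ∧ ∑ x, μ x = 1

/-- Maximum of a real-valued function over a finite nonempty type. -/
noncomputable def maxOver {A : Type*} [Fintype A] [Nonempty A] (f : A → ℝ) : ℝ :=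
  Finset.univ.sup' Finset.univ_nonempty f

/-- Maximal expected utility of attention strategy `α` under prior `μ` and utility `u`. -/
noncomputable def J {X Y A : Type*} [Fintype X] [Fintype Y] [Fintype A] [Nonempty A]
    (μ : X → ℝ) (α : X → Y → ℝ) (u : X → A → ℝ) : ℝ :=
  ∑ y, maxOver (fun a => ∑ x, μ x * α x y * u x a)

/-- Maximal expected utility of a direct strategy `p : X → A`. -/
noncomputable def JA {X A : Type*} [Fintype X] [Fintype A] [Nonempty A]
    (μ : X → ℝ) (p : X → A → ℝ) (u : X → A → ℝ) : ℝ :=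
  ∑ a, maxOver (fun b => ∑ x, μ x * p x a * u x b)

/-- `β` is an optimal decision rule for `(μ, α, u)`. -/
def OptimalRule {X Y A : Type*} [Fintype X] (μ : X → ℝ) (α : X → Y → ℝ)
    (u : X → A → ℝ) (β : Y → A → ℝ) : Prop :=
  ∀ y a, 0 < β y a → ∀ b, ∑ x, μ x * α x y * u x b ≤ ∑ x, μ x * α x y * u x a

/-- The NIAS (No-Improving-Action-Switches) inequalities. -/
def NIAS {X A : Type*} [Fintype X] (q u : X → A → ℝ) : Prop :=
  ∀ a b, ∑ x, q x a * (u x b - u x a) ≤ 0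

/-- The NIAC (No-Improving-Action-Cycles) inequalities for a collection of agents. -/
def NIAC {K X A : Type*} [Fintype X] [Fintype A] [Nonempty A]
    (q u : K → X → A → ℝ) (c : K → ℝ) : Prop :=
  ∀ j k, (∑ a, maxOver (fun b => ∑ x, q j x a * u k x b)) - c j
    - (∑ x, ∑ a, q k x a * u k x a) + c k ≤ 0

theorem le_maxOver {A : Type*} [Fintype A] [Nonempty A] (f : A → ℝ) (a : A) : f a ≤ maxOver f :=
  Finset.le_sup' f (Finset.mem_univ a)

theorem maxOver_le {A : Type*} [Fintype A] [Nonempty A] {f : A → ℝ} {r : ℝ}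
    (h : ∀ a, f a ≤ r) : maxOver f ≤ r :=
  Finset.sup'_le _ _ fun a _ => h a

theorem sum_revealed_mul {X Y A : Type*} [Fintype X] [Fintype Y]
    (μ : X → ℝ) (α : X → Y → ℝ) (β : Y → A → ℝ) (v : X → ℝ) (a : A) :
    ∑ x, μ x * (∑ y, β y a * α x y) * v x = ∑ y, β y a * ∑ x, μ x * α x y * v x := by
  simp_rw [Finset.mul_sum, Finset.sum_mul]
  rw [Finset.sum_comm]
  exact Finset.sum_congr rfl fun y _ => Finset.sum_congr rfl fun x _ => by ring

theorem sum_sum_kernel_mul {Y A : Type*} [Fintype Y] [Fintype A] {β : Y → A → ℝ}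
    (hβ : IsKernel β) (m : Y → ℝ) : ∑ a, ∑ y, β y a * m y = ∑ y, m y := by
  rw [Finset.sum_comm]
  exact Finset.sum_congr rfl fun y _ => by rw [← Finset.sum_mul, hβ.2 y, one_mul]

/-- Garbling a signal through a kernel does not increase the maximal expected utility. -/
theorem sum_maxOver_revealed_le_J {X Y A : Type*} [Fintype X] [Fintype Y] [Fintype A] [Nonempty A]
    (μ : X → ℝ) (α : X → Y → ℝ) (u : X → A → ℝ) {β : Y → A → ℝ} (hβ : IsKernel β) :
    ∑ a, maxOver (fun b => ∑ x, μ x * (∑ y, β y a * α x y) * u x b) ≤ J μ α u := by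
  rw [J, ← sum_sum_kernel_mul hβ]
  refine Finset.sum_le_sum fun a _ => maxOver_le fun b => ?_
  rw [sum_revealed_mul μ α β (fun x => u x b)]
  exact Finset.sum_le_sum fun y _ => mul_le_mul_of_nonneg_left
    (le_maxOver (fun b => ∑ x, μ x * α x y * u x b) b) (hβ.1 y a)

/-- An optimal decision rule attains the maximal expected utility. -/
theorem OptimalRule.J_eq {X Y A : Type*} [Fintype X] [Fintype Y] [Fintype A] [Nonempty A]
    {μ : X → ℝ} {α : X → Y → ℝ} {u : X → A → ℝ} {β : Y → A → ℝ}
    (h : OptimalRule μ α u β) (hβ : IsKernel β) :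
    ∑ x, ∑ a, μ x * (∑ y, β y a * α x y) * u x a = J μ α u := by
  rw [J, Finset.sum_comm, ← sum_sum_kernel_mul hβ]
  refine Finset.sum_congr rfl fun a _ => ?_
  rw [sum_revealed_mul μ α β (fun x => u x a)]
  refine Finset.sum_congr rfl fun y _ => ?_
  rcases (hβ.1 y a).eq_or_lt with h0 | h0
  · rw [← h0, zero_mul, zero_mul]
  · rw [le_antisymm (le_maxOver (fun b => ∑ x, μ x * α x y * u x b) a) (maxOver_le (h y a h0))]

/-- Necessity of NIAC for a collection of rationally inattentive utility
maximizers. -/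
theorem niac_necessity {X Y A K : Type*} [Fintype X] [Nonempty X]
    [Fintype Y] [Nonempty Y] [Fintype A] [Nonempty A] [Fintype K] [Nonempty K]
    (μ : X → ℝ) (hμ : IsPrior μ)
    (C : (X → Y → ℝ) → ℝ)
    (u : K → X → A → ℝ)
    (α : K → X → Y → ℝ) (hα : ∀ k, IsKernel (α k))
    (hatt : ∀ k, ∀ α' : X → Y → ℝ, IsKernel α' →
      J μ α' (u k) - C α' ≤ J μ (α k) (u k) - C (α k))
    (β : K → Y → A → ℝ) (hβ : ∀ k, IsKernel (β k))
    (hopt : ∀ k, OptimalRule μ (α k) (u k) (β k)) :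
    NIAC (fun k x a => μ x * ∑ y, β k y a * α k x y) u (fun k => C (α k)) := by
  intro j k
  have hgarble := sum_maxOver_revealed_le_J μ (α j) (u k) (hβ j)
  have hopt_eq := (hopt k).J_eq (hβ k)
  have hatt_jk := hatt k (α j) (hα j)
  linarith
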